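/- For any commutative ring R, FPD(R) ≤ cot.D(R) + FFD(R), where cot.D(R) is the supremum of projective dimensions of flat R-modules. -/

import Mathlib

open CategoryTheory Opposite

noncomputable section

universe u

variable (R : Type u) [CommRing R]

/-- `ExtVanish R M N n` : the `n`-th Ext group `Ext^n_R(M, N)` vanishes. -/
def ExtVanish (M N : ModuleCat.{u} R) (n : ℕ) : Prop :=
  Subsingleton (((Ext R (ModuleCat.{u} R) n).obj (op M)).obj N)

/-- `TorVanish R M N n` : the `n`-th Tor group `Tor_n^R(M, N)` vanishes. -/
def TorVanish (M N : ModuleCat.{u} R) (n : ℕ) : Prop :=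
  Subsingleton (((Tor (ModuleCat.{u} R) n).obj M).obj N)

/-- `pdLE R M n` : the projective dimension of `M` is at most `n`. -/
def pdLE (M : ModuleCat.{u} R) (n : ℕ) : Prop :=
  ∀ N : ModuleCat.{u} R, ExtVanish R M N (n + 1)

/-- `idLE R M n` : the injective dimension of `M` is at most `n`. -/
def idLE (M : ModuleCat.{u} R) (n : ℕ) : Prop :=
  ∀ N : ModuleCat.{u} R, ExtVanish R N M (n + 1)

/-- `fdLE R M n` : the flat dimension of `M` is at most `n`. -/
def fdLE (M : ModuleCat.{u} R) (n : ℕ) : Prop :=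
  ∀ N : ModuleCat.{u} R, TorVanish R M N (n + 1)

/-- `cdLE R M n` : the cotorsion dimension of `M` is at most `n`, i.e.
`Ext^{n+1}_R(F, M) = 0` for every flat `R`-module `F`. -/
def cdLE (M : ModuleCat.{u} R) (n : ℕ) : Prop :=
  ∀ F : ModuleCat.{u} R, Module.Flat R F → ExtVanish R F M (n + 1)

/-- The projective dimension of a module, as an element of `ℕ∞`. -/
def pd (M : ModuleCat.{u} R) : ℕ∞ := sInf ((↑) '' {n : ℕ | pdLE R M n})

/-- The injective dimension of a module, as an element of `ℕ∞`. -/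
def injd (M : ModuleCat.{u} R) : ℕ∞ := sInf ((↑) '' {n : ℕ | idLE R M n})

/-- The flat dimension of a module, as an element of `ℕ∞`. -/
def fd (M : ModuleCat.{u} R) : ℕ∞ := sInf ((↑) '' {n : ℕ | fdLE R M n})

/-- The cotorsion dimension of a module, as an element of `ℕ∞`. -/
def cd (M : ModuleCat.{u} R) : ℕ∞ := sInf ((↑) '' {n : ℕ | cdLE R M n})

/-- The global dimension of a ring. -/
def gldim : ℕ∞ := ⨆ M : ModuleCat.{u} R, pd R M

/-- The weak global dimension of a ring. -/
def wdim : ℕ∞ := ⨆ M : ModuleCat.{u} R, fd R M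

/-- The global cotorsion dimension of a ring: the supremum of the projective
dimensions of all flat modules. -/
def cotD : ℕ∞ := ⨆ (M : ModuleCat.{u} R) (_ : Module.Flat R M), pd R M

/-- The finitistic projective dimension of a ring. -/
def FPD : ℕ∞ := sSup {d : ℕ∞ | d ≠ ⊤ ∧ ∃ M : ModuleCat.{u} R, pd R M = d}

/-- The finitistic flat dimension of a ring. -/
def FFD : ℕ∞ := sSup {d : ℕ∞ | d ≠ ⊤ ∧ ∃ M : ModuleCat.{u} R, fd R M = d}

/-- The finitistic injective dimension of a ring. -/
def FID : ℕ∞ := sSup {d : ℕ∞ | d ≠ ⊤ ∧ ∃ M : ModuleCat.{u} R, injd R M = d}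

/-- The finitistic cotorsion dimension of a ring. -/
def FCD : ℕ∞ := sSup {d : ℕ∞ | d ≠ ⊤ ∧ ∃ M : ModuleCat.{u} R, cd R M = d}

/-- `R` is `n`-perfect if every flat `R`-module has projective dimension at most `n`. -/
def IsNPerfect (n : ℕ) : Prop :=
  ∀ M : ModuleCat.{u} R, Module.Flat R M → pd R M ≤ n

end

open CategoryTheory Opposite Limits MonoidalCategory

section
variable {R : Type u} [CommRing R]

lemma extVanish_iff (M N : ModuleCat.{u} R) (n : ℕ) :
    ExtVanish R M N (n + 1) ↔ Subsingleton (Abelian.Ext.{u} M N (n + 1)) := by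
  let Q := projectiveResolution M
  have h1 : ExtVanish R M N (n + 1) ↔ ∀ f : Q.complex.X (n+1) ⟶ N, Q.complex.d (n+2) (n+1) ≫ f = 0 →
      ∃ g : Q.complex.X n ⟶ N, Q.complex.d (n+1) n ≫ g = f := by
    unfold ExtVanish
    rw [← ModuleCat.isZero_iff_subsingleton, (Q.isoExt (n+1) N).isZero_iff,
      ← HomologicalComplex.exactAt_iff_isZero_homology,
      HomologicalComplex.exactAt_iff' _ n (n+1) (n+2) (by simp) (by simp),
      ShortComplex.moduleCat_exact_iff]
    rfl
  rw [h1]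
  constructor
  · intro h
    refine subsingleton_of_forall_eq 0 fun α => ?_
    obtain ⟨f, hf, rfl⟩ := Q.extMk_surjective α (n+2) rfl
    rw [Q.extMk_eq_zero_iff f (n+2) rfl hf n rfl]
    exact h f hf
  · intro h f hf
    rw [← Q.extMk_eq_zero_iff f (n+2) rfl hf n rfl]
    exact Subsingleton.elim _ _

lemma pdLE_iff (M : ModuleCat.{u} R) (n : ℕ) :
    pdLE R M n ↔ HasProjectiveDimensionLT M (n + 1) := by
  constructor
  · intro h
    apply hasProjectiveDimensionLT_of_enoughInjectives.{u}
    intro Y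
    exact (extVanish_iff M Y n).1 (h Y)
  · intro h N
    exact (extVanish_iff M N n).2 (HasProjectiveDimensionLT.subsingleton.{u} M (n+1) (n+1) le_rfl N)

lemma torVanish_iff (M : ModuleCat.{u} R) {N : ModuleCat.{u} R} (Q : ProjectiveResolution N) (n : ℕ) :
    TorVanish R M N (n + 1) ↔
      ((((tensoringLeft (ModuleCat.{u} R)).obj M).mapHomologicalComplex _).obj Q.complex).ExactAt (n+1) := by
  unfold TorVanish
  rw [← ModuleCat.isZero_iff_subsingleton, Tor_obj,
     (Q.isoLeftDerivedObj ((tensoringLeft (ModuleCat.{u} R)).obj M) (n+1)).isZero_iff,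
      HomologicalComplex.exactAt_iff_isZero_homology]
  rfl

lemma torVanish_iff' (M : ModuleCat.{u} R) {N : ModuleCat.{u} R} (Q : ProjectiveResolution N) (n : ℕ) :
    TorVanish R M N (n + 1) ↔
      Function.Exact ((Q.complex.d (n+2) (n+1)).hom.lTensor M) ((Q.complex.d (n+1) n).hom.lTensor M) := by
  rw [torVanish_iff M Q, HomologicalComplex.exactAt_iff' _ (n+2) (n+1) n (by simp) (by simp),
    ShortComplex.ShortExact.moduleCat_exact_iff_function_exact]
  rfl

lemma res_exact {N : ModuleCat.{u} R} (Q : ProjectiveResolution N) (n : ℕ) :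
    Function.Exact (Q.complex.d (n+2) (n+1)).hom (Q.complex.d (n+1) n).hom := by
  have := Q.exact_succ n
  rw [ShortComplex.ShortExact.moduleCat_exact_iff_function_exact] at this
  exact this

lemma res_exact0 {N : ModuleCat.{u} R} (Q : ProjectiveResolution N) :
    Function.Exact (Q.complex.d 1 0).hom (Q.π.f 0).hom := by
  have := Q.exact₀
  rw [ShortComplex.ShortExact.moduleCat_exact_iff_function_exact] at this
  exact this

lemma torVanish_flat (M N : ModuleCat.{u} R) [Module.Flat R M] (n : ℕ) :
    TorVanish R M N (n + 1) := by
  rw [torVanish_iff' M (projectiveResolution N)]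
  exact Module.Flat.lTensor_exact M (res_exact _ _)

/-- dimension shifting for Tor -/
lemma torVanish_shift (S : ShortComplex (ModuleCat.{u} R)) (hS : S.ShortExact)
    [Module.Flat R S.X₂] (N : ModuleCat.{u} R) (n : ℕ) :
    TorVanish R S.X₃ N (n + 2) ↔ TorVanish R S.X₁ N (n + 1) := by
  let Q := projectiveResolution N
  let F := tensoringLeft (ModuleCat.{u} R)
  let T : ShortComplex (ChainComplex (ModuleCat.{u} R) ℕ) :=
    ShortComplex.mk ((NatTrans.mapHomologicalComplex (F.map S.f) _).app Q.complex)
      ((NatTrans.mapHomologicalComplex (F.map S.g) _).app Q.complex) (by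
        ext i : 1
        change (S.f ▷ Q.complex.X i) ≫ (S.g ▷ Q.complex.X i) = 0
        rw [← comp_whiskerRight, S.zero]; exact MonoidalPreadditive.zero_whiskerRight)
  have hT : T.ShortExact := by
    apply HomologicalComplex.shortExact_of_degreewise_shortExact
    intro i
    have : Module.Projective R (Q.complex.X i) :=
      (IsProjective.iff_projective (Q.complex.X i)).2 (Q.projective i)
    have := hS.map_of_exact (tensorRight (Q.complex.X i))
    exact this
  rw [torVanish_iff _ Q, torVanish_iff _ Q, HomologicalComplex.exactAt_iff_isZero_homology,
    HomologicalComplex.exactAt_iff_isZero_homology]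
  have h1 := (HomologicalComplex.exactAt_iff_isZero_homology _ _).1 <|
    (torVanish_iff _ Q _).1 (torVanish_flat S.X₂ N (n+1))
  have h2 := (HomologicalComplex.exactAt_iff_isZero_homology _ _).1 <|
    (torVanish_iff _ Q _).1 (torVanish_flat S.X₂ N n)
  have hr : (ComplexShape.down ℕ).Rel (n+2) (n+1) := by simp
  have := hT.isIso_δ (n+2) (n+1) hr h1 h2
  exact (asIso (hT.δ (n+2) (n+1) hr)).isZero_iff

open TensorProduct

lemma tensor_comm {A B : Type*} [AddCommGroup A] [AddCommGroup B] [Module R A] [Module R B]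
    {C D : Type*} [AddCommGroup C] [AddCommGroup D] [Module R C] [Module R D]
    (f : A →ₗ[R] B) (g : C →ₗ[R] D) (x : A ⊗[R] C) :
    g.lTensor B (f.rTensor C x) = f.rTensor D (g.lTensor A x) := by
  rw [← LinearMap.comp_apply, ← LinearMap.comp_apply, LinearMap.lTensor_comp_rTensor,
    LinearMap.rTensor_comp_lTensor]

lemma inj_of_tor_one (S : ShortComplex (ModuleCat.{u} R)) (hS : S.ShortExact)
    (N : ModuleCat.{u} R) (h : TorVanish R S.X₃ N 1) :
    Function.Injective (S.f.hom.rTensor N) := by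
  let Q := projectiveResolution N
  have hf (i) : Module.Projective R (Q.complex.X i) :=
      (IsProjective.iff_projective (Q.complex.X i)).2 (Q.projective i)
  have hinj : Function.Injective S.f.hom := (ModuleCat.mono_iff_injective _).1 hS.mono_f
  have hsur : Function.Surjective S.g.hom := (ModuleCat.epi_iff_surjective _).1 hS.epi_g
  have hex : Function.Exact S.f.hom S.g.hom :=
    (ShortComplex.ShortExact.moduleCat_exact_iff_function_exact _).1 hS.exact
  obtain ⟨π, hπ, hπe⟩ : ∃ π : Q.complex.X 0 →ₗ[R] N, Function.Surjective π ∧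
      Function.Exact (Q.complex.d 1 0).hom π :=
    ⟨(Q.π.f 0).hom, (ModuleCat.epi_iff_surjective _).1 inferInstance, res_exact0 Q⟩
  have hT := (torVanish_iff' _ Q 0).1 h
  have e0 := lTensor_exact S.X₂ hπe hπ
  have e0' := lTensor_exact S.X₁ hπe hπ
  rw [injective_iff_map_eq_zero]
  intro z hz
  obtain ⟨z, rfl⟩ := LinearMap.lTensor_surjective S.X₁ hπ z
  rw [← tensor_comm] at hz
  obtain ⟨b, hb⟩ := (e0 _).1 hz
  have hc : (Q.complex.d 1 0).hom.lTensor S.X₃ (S.g.hom.rTensor _ b) = 0 := by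
    rw [tensor_comm]
    erw [hb]
    exact (rTensor_exact (Q.complex.X 0) hex hsur).apply_apply_eq_zero z
  obtain ⟨c, hc⟩ := (hT _).1 hc
  obtain ⟨e, rfl⟩ := LinearMap.rTensor_surjective _ hsur c
  rw [tensor_comm] at hc
  have hk : S.g.hom.rTensor _ (b - (Q.complex.d 2 1).hom.lTensor S.X₂ e) = 0 := by
    rw [map_sub, sub_eq_zero]; exact hc.symm
  obtain ⟨k, hk⟩ := (rTensor_exact (Q.complex.X 1) hex hsur _).1 hk
  rw [e0']
  refine ⟨k, ?_⟩
  apply Module.Flat.rTensor_preserves_injective_linearMap (M := Q.complex.X 0) S.f.hom hinj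
  rw [← tensor_comm, hk, map_sub]
  erw [hb, ← LinearMap.comp_apply, ← LinearMap.lTensor_comp, (res_exact Q 0).linearMap_comp_eq_zero]
  simp

lemma exists_ses (M : ModuleCat.{u} R) : ∃ S : ShortComplex (ModuleCat.{u} R), S.ShortExact ∧
      Projective S.X₂ ∧ S.X₃ = M := by
  let p := Projective.π M
  refine ⟨ShortComplex.mk (kernel.ι p) p (by simp), ?_, ?_, rfl⟩
  · exact { exact := ShortComplex.exact_kernel p }
  · dsimp; infer_instance

lemma flat_of_projective (M : ModuleCat.{u} R) (h : Projective M) : Module.Flat R M := by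
  have := (IsProjective.iff_projective M).2 h
  infer_instance

lemma flat_of_fdLE_zero (M : ModuleCat.{u} R) (h : fdLE R M 0) : Module.Flat R M := by
  obtain ⟨S, hS, hP, rfl⟩ := exists_ses M
  have := flat_of_projective _ hP
  have hinj := fun N => inj_of_tor_one S hS N (h N)
  have hsur : Function.Surjective S.g.hom := (ModuleCat.epi_iff_surjective _).1 hS.epi_g
  have hex : Function.Exact S.f.hom S.g.hom :=
    (ShortComplex.ShortExact.moduleCat_exact_iff_function_exact _).1 hS.exact
  rw [Module.Flat.iff_lTensor_preserves_injective_linearMap]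
  intro N N' _ _ _ _ i hi
  rw [injective_iff_map_eq_zero]
  intro x hx
  obtain ⟨y, rfl⟩ := LinearMap.rTensor_surjective _ hsur x
  rw [tensor_comm] at hx
  obtain ⟨z, hz⟩ := (rTensor_exact N' hex hsur _).1 hx
  have hq : Function.Exact i (LinearMap.range i).mkQ := LinearMap.exact_map_mkQ_range i
  have hqs := (LinearMap.range i).mkQ_surjective
  have hz0 : (LinearMap.range i).mkQ.lTensor S.X₁ z = 0 := by
    apply hinj (ModuleCat.of R (N' ⧸ LinearMap.range i))
    erw [← tensor_comm, hz, (lTensor_exact S.X₂ hq hqs).apply_apply_eq_zero]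
    simp
  obtain ⟨w, rfl⟩ := (lTensor_exact S.X₁ hq hqs _).1 hz0
  rw [← tensor_comm] at hz
  have := Module.Flat.lTensor_preserves_injective_linearMap (M := S.X₂) i hi hz
  rw [← this]
  exact (rTensor_exact N hex hsur).apply_apply_eq_zero w

lemma fdLE_of_pdLE (n : ℕ) : ∀ (M : ModuleCat.{u} R), pdLE R M n → fdLE R M n := by
  induction n with
  | zero =>
    intro M h N
    rw [pdLE_iff, zero_add, ← projective_iff_hasProjectiveDimensionLT_one] at h
    have := flat_of_projective M h
    exact torVanish_flat M N 0
  | succ n ih =>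
    intro M h N
    obtain ⟨S, hS, hP, rfl⟩ := exists_ses M
    have := flat_of_projective _ hP
    rw [pdLE_iff, hS.hasProjectiveDimensionLT_X₃_iff n hP, ← pdLE_iff] at h
    exact (torVanish_shift S hS N n).2 (ih _ h N)

lemma pdLE_of_fdLE (c : ℕ) (hc : ∀ F : ModuleCat.{u} R, Module.Flat R F → pdLE R F c) (n : ℕ) :
    ∀ (M : ModuleCat.{u} R), fdLE R M n → pdLE R M (c + n) := by
  induction n with
  | zero => exact fun M h => hc M (flat_of_fdLE_zero M h)
  | succ n ih =>
    intro M h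
    obtain ⟨S, hS, hP, rfl⟩ := exists_ses M
    have := flat_of_projective _ hP
    rw [pdLE_iff, ← add_assoc, hS.hasProjectiveDimensionLT_X₃_iff _ hP, ← pdLE_iff]
    exact ih _ fun N => (torVanish_shift S hS N n).1 (h N)

lemma pd_le_iff (M : ModuleCat.{u} R) (n : ℕ) : pd R M ≤ n ↔ pdLE R M n := by
  constructor
  · intro h
    have hne : (((↑) : ℕ → ℕ∞) '' {n : ℕ | pdLE R M n}).Nonempty := by
      by_contra hne
      rw [Set.not_nonempty_iff_eq_empty] at hne
      simp [pd, hne] at h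
    obtain ⟨k, hk, hk'⟩ := csInf_mem hne
    change _ = pd R M at hk'
    rw [← hk', Nat.cast_le] at h
    rw [pdLE_iff]
    have := (pdLE_iff _ _).1 hk
    exact hasProjectiveDimensionLT_of_ge M (k+1) (n+1) (by omega)
  · intro h
    exact sInf_le ⟨n, h, rfl⟩

end

/-- For any commutative ring `R`, `FPD R ≤ cot.D R + FFD R`. -/
theorem stmt_4 (R : Type u) [CommRing R] :
    FPD R ≤ cotD R + FFD R := by
  apply sSup_le
  rintro _ ⟨hd, M, rfl⟩
  obtain ⟨d, hd⟩ := ENat.ne_top_iff_exists.1 hd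
  have hM : pdLE R M d := (pd_le_iff M d).1 hd.symm.le
  have hne : (((↑) : ℕ → ℕ∞) '' {n : ℕ | fdLE R M n}).Nonempty := ⟨_, d, fdLE_of_pdLE d M hM, rfl⟩
  obtain ⟨f, hf, hf'⟩ := csInf_mem hne
  change _ = fd R M at hf'
  have hF : (f : ℕ∞) ≤ FFD R := le_sSup ⟨by simp, M, hf'.symm⟩
  by_cases hc : cotD R = ⊤
  · simp [hc]
  obtain ⟨c, hc⟩ := ENat.ne_top_iff_exists.1 hc
  have key : pdLE R M (c + f) := by
    refine pdLE_of_fdLE c (fun F hF => (pd_le_iff F c).1 ?_) f M hf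
    rw [hc]
    exact le_iSup₂_of_le F hF le_rfl
  calc pd R M ≤ ((c + f : ℕ) : ℕ∞) := (pd_le_iff _ _).2 key
    _ = c + f := by push_cast; rfl
    _ ≤ _ := by rw [hc]; gcongr
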